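/- Let v_1,...,v_n span ℝ^k. The function (t_1,...,t_n) ↦ ∫_{(0,∞)^n} (det(∑_{i=1}^n e^{t_i} y_i v_i v_iᵀ))^{-1/2} e^{-∑ y_i} dy is log-concave on ℝ^n, provided the integral is finite for all t. -/

import Mathlib

open MeasureTheory

lemma bm_add (A B C : Set ℝ) (hA : MeasurableSet A) (hB : MeasurableSet B)
    (hAn : A.Nonempty) (hBn : B.Nonempty) (h : ∀ a ∈ A, ∀ b ∈ B, a + b ∈ C) :
    volume A + volume B ≤ volume C := by
  obtain ⟨a0, ha0⟩ := hAn
  obtain ⟨b0, hb0⟩ := hBn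
  have key : ∀ K, K ⊆ A → IsCompact K → ∀ L, L ⊆ B → IsCompact L →
      volume K + volume L ≤ volume C := by
    intro K hK hKc L hL hLc
    rcases K.eq_empty_or_nonempty with rfl | hKn
    · rw [measure_empty, zero_add, ← measure_preimage_add volume (-a0) L]
      refine measure_mono fun x hx => ?_
      have := h a0 ha0 _ (hL hx)
      simpa using this
    rcases L.eq_empty_or_nonempty with rfl | hLn
    · rw [measure_empty, add_zero, ← measure_preimage_add volume (-b0) K]
      refine measure_mono fun x hx => ?_
      have := h _ (hK hx) b0 hb0
      simpa using this
    obtain ⟨a, haK, ha⟩ := hKc.exists_isGreatest hKn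
    obtain ⟨b, hbL, hb⟩ := hLc.exists_isLeast hLn
    rw [← measure_preimage_add volume (-b) K, ← measure_preimage_add volume (-a) L]
    rw [← measure_union₀]
    · refine measure_mono fun x hx => ?_
      rcases hx with hx | hx
      · have := h _ (hK hx) b (hL hbL)
        simpa using this
      · have := h a (hK haK) _ (hL hx)
        simpa using this
    · exact (measurable_const_add (-a) hLc.measurableSet).nullMeasurableSet
    · refine measure_mono_null (t := {a + b}) ?_ (by simp)
      rintro x ⟨h1, h2⟩
      have e1 := ha h1
      have e2 := hb h2
      simp only [Set.mem_singleton_iff]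
      linarith
  rw [hA.measure_eq_iSup_isCompact, hB.measure_eq_iSup_isCompact]
  simp only [iSup_and']
  refine ENNReal.biSup_add_biSup_le' (p := fun K => K ⊆ A ∧ IsCompact K) (q := fun K => K ⊆ B ∧ IsCompact K) ⟨∅, by simp⟩ ⟨∅, by simp⟩ ?_
  intro K hK L hL
  exact key K hK.1 hK.2 L hL.1 hL.2

lemma bm_conv (l : ℝ) (hl : 0 < l) (hl1 : l < 1) (A B C : Set ℝ)
    (hA : MeasurableSet A) (hB : MeasurableSet B)
    (hAn : A.Nonempty) (hBn : B.Nonempty) (h : ∀ a ∈ A, ∀ b ∈ B, l * a + (1 - l) * b ∈ C) :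
    ENNReal.ofReal l * volume A + ENNReal.ofReal (1 - l) * volume B ≤ volume C := by
  have hl2 : 0 < 1 - l := by linarith
  have h1 := Measure.addHaar_smul (volume : Measure ℝ) l A
  have h2 := Measure.addHaar_smul (volume : Measure ℝ) (1 - l) B
  simp only [Module.finrank_self, pow_one, abs_of_pos hl, abs_of_pos hl2] at h1 h2
  rw [← h1, ← h2]
  open Pointwise in
  refine bm_add _ _ _ (hA.const_smul₀ l) (hB.const_smul₀ (1 - l)) (hAn.smul_set) (hBn.smul_set) ?_
  rintro _ ⟨a, ha, rfl⟩ _ ⟨b, hb, rfl⟩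
  exact h a ha b hb

lemma pl_real (l : ℝ) (hl : 0 < l) (hl1 : l < 1) (f g h : ℝ → ℝ)
    (hf : Measurable f) (hg : Measurable g) (hh : Measurable h)
    (f0 : ∀ x, 0 ≤ f x) (g0 : ∀ x, 0 ≤ g x) (h0 : ∀ x, 0 ≤ h x)
    (f1 : ∀ x, f x ≤ 1) (g1 : ∀ x, g x ≤ 1)
    (fs : ∀ s < 1, ∃ x, s < f x) (gs : ∀ s < 1, ∃ x, s < g x)
    (H : ∀ x y, f x ^ l * g y ^ (1 - l) ≤ h (l * x + (1 - l) * y)) :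
    ENNReal.ofReal l * (∫⁻ x, ENNReal.ofReal (f x)) +
      ENNReal.ofReal (1 - l) * (∫⁻ x, ENNReal.ofReal (g x)) ≤ ∫⁻ x, ENNReal.ofReal (h x) := by
  have hl2 : 0 < 1 - l := by linarith
  rw [lintegral_eq_lintegral_meas_lt _ (.of_forall f0) hf.aemeasurable,
    lintegral_eq_lintegral_meas_lt _ (.of_forall g0) hg.aemeasurable,
    lintegral_eq_lintegral_meas_lt _ (.of_forall h0) hh.aemeasurable,
    ← lintegral_const_mul' _ _ ENNReal.ofReal_ne_top,
    ← lintegral_const_mul' _ _ ENNReal.ofReal_ne_top, ← lintegral_add_left]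
  · refine setLIntegral_mono' measurableSet_Ioi fun s hs => ?_
    rcases lt_or_ge s 1 with h1 | h1
    · refine bm_conv l hl hl1 _ _ _ (measurableSet_lt measurable_const hf)
        (measurableSet_lt measurable_const hg) (fs s h1) (gs s h1) ?_
      intro a ha b hb
      refine lt_of_lt_of_le ?_ (H a b)
      have hs : 0 < s := hs
      calc s = s ^ l * s ^ (1 - l) := by rw [← Real.rpow_add hs]; simp
        _ < _ := by
          apply mul_lt_mul''
          · exact Real.rpow_lt_rpow hs.le ha hl
          · exact Real.rpow_lt_rpow hs.le hb hl2
          · positivity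
          · positivity
    · have e1 : {a | s < f a} = ∅ := by
        ext x; simpa using (f1 x).trans h1
      have e2 : {a | s < g a} = ∅ := by
        ext x; simpa using (g1 x).trans h1
      simp [e1, e2]
  · apply Measurable.const_mul
    apply Antitone.measurable
    intro a b hab
    exact measure_mono fun x hx => lt_of_le_of_lt hab hx

lemma amgm (l : ℝ) (hl : 0 < l) (hl1 : l < 1) (a b : ENNReal) :
    a ^ l * b ^ (1 - l) ≤ ENNReal.ofReal l * a + ENNReal.ofReal (1 - l) * b := by
  have hl2 : 0 < 1 - l := by linarith
  have hpq : (l⁻¹).HolderConjugate (1 - l)⁻¹ := by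
    rw [Real.holderConjugate_iff]
    refine ⟨(one_lt_inv₀ hl).2 hl1, by simp⟩
  have := ENNReal.young_inequality (a ^ l) (b ^ (1 - l)) hpq
  rw [← ENNReal.rpow_mul, ← ENNReal.rpow_mul, mul_inv_cancel₀ hl.ne', mul_inv_cancel₀ hl2.ne',
    ENNReal.rpow_one, ENNReal.rpow_one, div_eq_mul_inv, div_eq_mul_inv,
    ← ENNReal.ofReal_inv_of_pos (by positivity), ← ENNReal.ofReal_inv_of_pos (by positivity),
    inv_inv, inv_inv, mul_comm a, mul_comm b] at this
  exact this

lemma pl_bdd (l : ℝ) (hl : 0 < l) (hl1 : l < 1) (f g h : ℝ → ENNReal)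
    (hf : Measurable f) (hg : Measurable g) (hh : Measurable h)
    (fs : ⨆ x, f x ≠ ⊤) (gs : ⨆ x, g x ≠ ⊤)
    (H : ∀ x y, f x ^ l * g y ^ (1 - l) ≤ h (l * x + (1 - l) * y)) :
    (∫⁻ x, f x) ^ l * (∫⁻ x, g x) ^ (1 - l) ≤ ∫⁻ x, h x := by
  have hl2 : 0 < 1 - l := by linarith
  set M := ⨆ x, f x with hM
  set N := ⨆ x, g x with hN
  by_cases M0 : M = 0
  · have : ∀ x, f x = 0 := by simpa [hM] using M0
    simp [this, hl]
  by_cases N0 : N = 0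
  · have : ∀ x, g x = 0 := by simpa [hN] using N0
    simp [this, hl1]
  set c := M ^ l * N ^ (1 - l) with hc
  have c0 : c ≠ 0 := by
    simp [hc, M0, N0, fs, gs]
  have ct : c ≠ ⊤ := by
    apply ENNReal.mul_ne_top <;> apply ENNReal.rpow_ne_top_of_nonneg <;> first | assumption | positivity
  have fM : ∀ x, f x / M ≤ 1 := fun x => ENNReal.div_le_of_le_mul (by simpa using le_iSup f x)
  have gN : ∀ x, g x / N ≤ 1 := fun x => ENNReal.div_le_of_le_mul (by simpa using le_iSup g x)
  have sup : ∀ (f : ℝ → ENNReal) (M : ENNReal), M = (⨆ x, f x) → M ≠ 0 → M ≠ ⊤ → (∀ x, f x / M ≤ 1) →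
      ∀ s < 1, ∃ x, s < (f x / M).toReal := by
    intro f M hM M0 fs fM s hs
    have : ENNReal.ofReal s * M < M := by
      calc _ < 1 * M := by
            rw [ENNReal.mul_lt_mul_iff_left M0 fs]
            simpa using hs
        _ = M := one_mul _
    conv_rhs at this => rw [hM]
    obtain ⟨x, hx⟩ := lt_iSup_iff.1 this
    refine ⟨x, ?_⟩
    by_contra! hc
    have h1 := ENNReal.ofReal_le_ofReal hc
    rw [ENNReal.ofReal_toReal ((fM x).trans_lt ENNReal.one_lt_top).ne,
      ENNReal.div_le_iff M0 fs] at h1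
    exact absurd hx (not_lt.2 h1)
  have key := pl_real l hl hl1 (fun x => (f x / M).toReal) (fun x => (g x / N).toReal)
    (fun x => (min 1 (h x / c)).toReal) (by fun_prop) (by fun_prop) (by fun_prop)
    (fun _ => ENNReal.toReal_nonneg) (fun _ => ENNReal.toReal_nonneg)
    (fun _ => ENNReal.toReal_nonneg) (fun x => ENNReal.toReal_le_of_le_ofReal (by simp) (by simpa using fM x))
    (fun x => ENNReal.toReal_le_of_le_ofReal (by simp) (by simpa using gN x))
    (sup f M rfl M0 fs fM) (sup g N rfl N0 gs gN) ?_
  · have ft : ∀ x, f x / M ≠ ⊤ := fun x => ((fM x).trans_lt ENNReal.one_lt_top).ne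
    have gt : ∀ x, g x / N ≠ ⊤ := fun x => ((gN x).trans_lt ENNReal.one_lt_top).ne
    have ht : ∀ x, min 1 (h x / c) ≠ ⊤ := fun x => ((min_le_left _ _).trans_lt ENNReal.one_lt_top).ne
    simp only [ENNReal.ofReal_toReal (ft _), ENNReal.ofReal_toReal (gt _), ENNReal.ofReal_toReal (ht _)] at key
    have k2 := (amgm l hl hl1 _ _).trans (key.trans (lintegral_mono fun x => min_le_right _ _))
    simp only [div_eq_mul_inv] at k2
    rw [lintegral_mul_const _ hf, lintegral_mul_const _ hg, lintegral_mul_const _ hh,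
      ENNReal.mul_rpow_of_nonneg _ _ hl.le, ENNReal.mul_rpow_of_nonneg _ _ hl2.le, 
      mul_mul_mul_comm, ENNReal.inv_rpow, ENNReal.inv_rpow, ← ENNReal.mul_inv] at k2
    · exact (ENNReal.mul_le_mul_iff_left (ENNReal.inv_ne_zero.2 ct) (ENNReal.inv_ne_top.2 c0)).1 k2
    · left; simp [M0, fs]
    · right; simp [N0, gs]
  · intro x y
    rw [ENNReal.toReal_rpow, ENNReal.toReal_rpow, ← ENNReal.toReal_mul]
    apply ENNReal.toReal_mono
    · simp
    · refine le_min ?_ ?_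
      · exact mul_le_one' (ENNReal.rpow_le_one (fM x) hl.le) (ENNReal.rpow_le_one (gN y) hl2.le)
      · rw [ENNReal.div_rpow_of_nonneg _ _ hl.le, ENNReal.div_rpow_of_nonneg _ _ hl2.le]
        simp only [div_eq_mul_inv]
        rw [mul_mul_mul_comm, ← ENNReal.mul_inv]
        · gcongr; exact H x y
        · left; simp [M0, fs]
        · right; simp [N0, gs]

lemma pl_one (l : ℝ) (hl : 0 < l) (hl1 : l < 1) (f g h : ℝ → ENNReal)
    (hf : Measurable f) (hg : Measurable g) (hh : Measurable h)
    (H : ∀ x y, f x ^ l * g y ^ (1 - l) ≤ h (l * x + (1 - l) * y)) :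
    (∫⁻ x, f x) ^ l * (∫⁻ x, g x) ^ (1 - l) ≤ ∫⁻ x, h x := by
  have hl2 : 0 < 1 - l := by linarith
  have key : ∀ n : ℕ, (∫⁻ x, min (f x) n) ^ l * (∫⁻ x, min (g x) n) ^ (1 - l) ≤ ∫⁻ x, h x := by
    intro n
    have nt : (n : ENNReal) < ⊤ := by simp
    refine pl_bdd l hl hl1 _ _ h (by fun_prop) (by fun_prop) hh 
      ((iSup_le fun x => min_le_right _ _).trans_lt nt).ne
      ((iSup_le fun x => min_le_right _ _).trans_lt nt).ne ?_
    intro x y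
    refine le_trans ?_ (H x y)
    gcongr <;> exact min_le_left _ _
  have lim : ∀ f : ℝ → ENNReal, Measurable f →
      Filter.Tendsto (fun n : ℕ => ∫⁻ x, min (f x) n) Filter.atTop (nhds (∫⁻ x, f x)) := by
    intro f hf
    apply lintegral_tendsto_of_tendsto_of_monotone
    · intro n; fun_prop
    · refine .of_forall fun x m n hmn => ?_
      dsimp only
      gcongr
    · refine .of_forall fun x => ?_
      have := (tendsto_const_nhds (x := f x)).min ENNReal.tendsto_nat_nhds_top
      simpa using this
  by_cases f0 : ∫⁻ x, f x = 0
  · simp [f0, hl]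
  by_cases g0 : ∫⁻ x, g x = 0
  · simp [g0, hl1]
  refine le_of_tendsto' (x := Filter.atTop) ?_ key
  apply ENNReal.Tendsto.mul
  · exact ((ENNReal.continuous_rpow_const (y := l)).tendsto _).comp (lim f hf)
  · left; simp [f0, hl.le]
  · exact ((ENNReal.continuous_rpow_const (y := 1 - l)).tendsto _).comp (lim g hg)
  · left; simp [g0, hl1.le]

lemma lint_exp (f : ℝ → ENNReal) :
    ∫⁻ x in Set.Ioi (0 : ℝ), f x = ∫⁻ x, ENNReal.ofReal (Real.exp x) * f (Real.exp x) := by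
  have := lintegral_image_eq_lintegral_abs_deriv_mul (s := Set.univ) (f := Real.exp)
    (f' := Real.exp) MeasurableSet.univ (fun x _ => (Real.hasDerivAt_exp x).hasDerivWithinAt)
    Real.exp_injective.injOn f
  simpa [Real.range_exp, Real.abs_exp] using this

lemma pl_mul_one (l : ℝ) (hl : 0 < l) (hl1 : l < 1) (f g h : ℝ → ENNReal)
    (hf : Measurable f) (hg : Measurable g) (hh : Measurable h)
    (H : ∀ x y, 0 < x → 0 < y → f x ^ l * g y ^ (1 - l) ≤ h (x ^ l * y ^ (1 - l))) :
    (∫⁻ x in Set.Ioi (0 : ℝ), f x) ^ l * (∫⁻ x in Set.Ioi (0 : ℝ), g x) ^ (1 - l)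
      ≤ ∫⁻ x in Set.Ioi (0 : ℝ), h x := by
  have hl2 : 0 < 1 - l := by linarith
  rw [lint_exp, lint_exp, lint_exp]
  refine pl_one l hl hl1 _ _ _ (by fun_prop) (by fun_prop) (by fun_prop) ?_
  intro x y
  have e : Real.exp (l * x + (1 - l) * y) = Real.exp x ^ l * Real.exp y ^ (1 - l) := by
    rw [← Real.exp_mul, ← Real.exp_mul, ← Real.exp_add]; ring_nf
  rw [ENNReal.mul_rpow_of_nonneg _ _ hl.le, ENNReal.mul_rpow_of_nonneg _ _ hl2.le,
    mul_mul_mul_comm, e, ENNReal.ofReal_mul (by positivity),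
    ENNReal.ofReal_rpow_of_pos (Real.exp_pos _), ENNReal.ofReal_rpow_of_pos (Real.exp_pos _)]
  gcongr
  exact H _ _ (Real.exp_pos _) (Real.exp_pos _)

lemma pl_mul (l : ℝ) (hl : 0 < l) (hl1 : l < 1) (n : ℕ) : ∀ (f g h : (Fin n → ℝ) → ENNReal)
    (_ : Measurable f) (_ : Measurable g) (_ : Measurable h)
    (_ : ∀ x y, (∀ i, 0 < x i) → (∀ i, 0 < y i) →
      f x ^ l * g y ^ (1 - l) ≤ h (fun i => x i ^ l * y i ^ (1 - l))),
    (∫⁻ x, f x ∂(Measure.pi fun _ => volume.restrict (Set.Ioi (0 : ℝ)))) ^ l *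
    (∫⁻ x, g x ∂(Measure.pi fun _ => volume.restrict (Set.Ioi (0 : ℝ)))) ^ (1 - l)
      ≤ ∫⁻ x, h x ∂(Measure.pi fun _ => volume.restrict (Set.Ioi (0 : ℝ))) := by
  have hl2 : 0 < 1 - l := by linarith
  induction n with
  | zero =>
    intro f g h hf hg hh H
    rw [Measure.pi_of_empty _ 0, lintegral_dirac, lintegral_dirac, lintegral_dirac]
    convert H 0 0 (by simp) (by simp) using 2
  | succ n ih =>
    intro f g h hf hg hh H
    have split : ∀ f : (Fin (n + 1) → ℝ) → ENNReal, Measurable f →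
        ∫⁻ x, f x ∂(Measure.pi fun _ => volume.restrict (Set.Ioi (0 : ℝ))) =
        ∫⁻ a in Set.Ioi (0 : ℝ), ∫⁻ x, f (Fin.cons a x) ∂(Measure.pi fun _ => volume.restrict (Set.Ioi (0 : ℝ))) := by
      intro f hf
      rw [← ((measurePreserving_piFinSuccAbove (fun _ : Fin (n + 1) => volume.restrict (Set.Ioi (0 : ℝ))) 0).symm).lintegral_comp hf, lintegral_prod]
      · simp [MeasurableEquiv.piFinSuccAbove, Fin.insertNthEquiv]
      · exact (hf.comp (MeasurableEquiv.measurable _)).aemeasurable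
    have cm : ∀ f : (Fin (n + 1) → ℝ) → ENNReal, Measurable f →
        Measurable (fun p : ℝ × (Fin n → ℝ) => f (Fin.cons p.1 p.2)) := by
      intro f hf
      have := hf.comp (MeasurableEquiv.piFinSuccAbove (fun _ : Fin (n + 1) => ℝ) 0).symm.measurable
      simpa [MeasurableEquiv.piFinSuccAbove, Fin.insertNthEquiv, Function.comp_def] using this
    rw [split f hf, split g hg, split h hh]
    refine pl_mul_one l hl hl1 _ _ _ (cm f hf).lintegral_prod_right' (cm g hg).lintegral_prod_right'
      (cm h hh).lintegral_prod_right' ?_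
    intro a b ha hb
    refine ih _ _ _ ((cm f hf).comp measurable_prodMk_left) ((cm g hg).comp measurable_prodMk_left)
      ((cm h hh).comp measurable_prodMk_left) ?_
    intro x y hx hy
    have := H (Fin.cons a x) (Fin.cons b y) (Fin.cases ha hx) (Fin.cases hb hy)
    convert this using 2
    ext i
    refine Fin.cases ?_ (fun j => ?_) i <;> simp

lemma cb (n k : ℕ) (v : Fin n → Fin k → ℝ) (w : Fin n → ℝ) :
    (k.factorial : ℝ) * (∑ i, w i • Matrix.vecMulVec (v i) (v i)).det =
      ∑ p : Fin k → Fin n, (Matrix.of fun a b => v (p a) b).det ^ 2 * ∏ a, w (p a) := by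
  have h1 : (∑ i, w i • Matrix.vecMulVec (v i) (v i)).det =
      ∑ p : Fin k → Fin n, (∏ a, w (p a)) * ((∏ a, v (p a) a) * (Matrix.of fun a b => v (p a) b).det) := by
    have e : (∑ i, w i • Matrix.vecMulVec (v i) (v i)) =
      fun a => ∑ i, (w i * v i a) • v i := by
      ext a b
      simp [Matrix.sum_apply, Matrix.vecMulVec_apply, Finset.sum_apply, mul_assoc]
    have := (Matrix.detRowAlternating (n := Fin k) (R := ℝ)).toMultilinearMap.map_sum
      (fun a (i : Fin n) => (w i * v i a) • v i)
    rw [e]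
    refine this.trans (Finset.sum_congr rfl fun p _ => ?_)
    rw [MultilinearMap.map_smul_univ, Finset.prod_mul_distrib, smul_eq_mul, mul_assoc]
    rfl
  have h2 : ∀ σ : Equiv.Perm (Fin k), (∑ i, w i • Matrix.vecMulVec (v i) (v i)).det =
      ∑ p : Fin k → Fin n, (∏ a, w (p a)) * ((Equiv.Perm.sign σ : ℝ) * (∏ a, v (p (σ a)) a) * (Matrix.of fun a b => v (p a) b).det) := by
    intro σ
    rw [h1, ← (Equiv.arrowCongr σ.symm (Equiv.refl (Fin n))).sum_comp]
    refine Finset.sum_congr rfl fun p _ => ?_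
    have e1 : ∏ a, w ((Equiv.arrowCongr σ.symm (Equiv.refl (Fin n))) p a) = ∏ a, w (p a) := by
      simpa using Equiv.prod_comp σ (fun a => w (p a))
    have e2 := Matrix.det_permute σ (Matrix.of fun a b => v (p a) b)
    rw [e1]
    have e3 : (Matrix.of fun a b => v ((Equiv.arrowCongr σ.symm (Equiv.refl (Fin n))) p a) b) =
      (Matrix.of fun a b => v (p a) b).submatrix σ id := by
      ext a b; simp
    rw [e3, e2]
    simp only [Equiv.arrowCongr_apply, Equiv.symm_symm, Function.comp_apply, Equiv.coe_refl, id_eq]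
    ring
  have h3 : (k.factorial : ℝ) * (∑ i, w i • Matrix.vecMulVec (v i) (v i)).det =
     ∑ _σ : Equiv.Perm (Fin k), (∑ i, w i • Matrix.vecMulVec (v i) (v i)).det := by
    simp [Fintype.card_perm]
  rw [h3, Finset.sum_congr rfl (fun σ _ => h2 σ), Finset.sum_comm]
  refine Finset.sum_congr rfl fun p _ => ?_
  rw [← Finset.mul_sum, ← Finset.sum_mul, mul_comm, sq]
  congr 2
  rw [Matrix.det_apply']
  rfl

lemma holder (l : ℝ) (hl : 0 < l) (hl1 : l < 1) {ι : Type*} [Fintype ι] (c a b : ι → ℝ)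
    (hc : ∀ i, 0 ≤ c i) (ha : ∀ i, 0 ≤ a i) (hb : ∀ i, 0 ≤ b i) :
    ∑ i, c i * (a i ^ l * b i ^ (1 - l)) ≤ (∑ i, c i * a i) ^ l * (∑ i, c i * b i) ^ (1 - l) := by
  have hl2 : 0 < 1 - l := by linarith
  have hpq : (l⁻¹).HolderConjugate (1 - l)⁻¹ := by
    rw [Real.holderConjugate_iff]
    refine ⟨(one_lt_inv₀ hl).2 hl1, by simp⟩
  have ca : ∀ i, 0 ≤ c i * a i := fun i => mul_nonneg (hc i) (ha i)
  have cbb : ∀ i, 0 ≤ c i * b i := fun i => mul_nonneg (hc i) (hb i)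
  have := Real.inner_le_Lp_mul_Lq_of_nonneg Finset.univ hpq (f := fun i => (c i * a i) ^ l)
    (g := fun i => (c i * b i) ^ (1 - l)) (fun i _ => Real.rpow_nonneg (ca i) _)
    (fun i _ => Real.rpow_nonneg (cbb i) _)
  simp only [← Real.rpow_mul (ca _), ← Real.rpow_mul (cbb _), mul_inv_cancel₀ hl.ne',
    mul_inv_cancel₀ hl2.ne', Real.rpow_one, one_div, inv_inv] at this
  refine le_trans (le_of_eq (Finset.sum_congr rfl fun i _ => ?_)) this
  rw [Real.mul_rpow (hc i) (ha i), Real.mul_rpow (hc i) (hb i), mul_mul_mul_comm,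
    ← Real.rpow_add' (hc i) (by simp)]
  simp

lemma det_nonneg' (n k : ℕ) (v : Fin n → Fin k → ℝ) (w : Fin n → ℝ) (hw : ∀ i, 0 < w i) :
    0 ≤ (∑ i, w i • Matrix.vecMulVec (v i) (v i)).det := by
  have hk : (0 : ℝ) < k.factorial := by positivity
  refine nonneg_of_mul_nonneg_right (a := (k.factorial : ℝ)) ?_ hk
  rw [cb]
  exact Finset.sum_nonneg fun p _ => mul_nonneg (sq_nonneg _) (Finset.prod_nonneg fun a _ => (hw _).le)

lemma det_pos' (n k : ℕ) (v : Fin n → Fin k → ℝ) (w w' : Fin n → ℝ) (hw : ∀ i, 0 < w i)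
    (hw' : ∀ i, 0 < w' i) (h : (∑ i, w i • Matrix.vecMulVec (v i) (v i)).det ≠ 0) :
    0 < (∑ i, w' i • Matrix.vecMulVec (v i) (v i)).det := by
  have hk : (0 : ℝ) < k.factorial := by positivity
  refine pos_of_mul_pos_right (a := (k.factorial : ℝ)) ?_ hk.le
  have h1 : (k.factorial : ℝ) * (∑ i, w i • Matrix.vecMulVec (v i) (v i)).det ≠ 0 :=
    mul_ne_zero hk.ne' h
  rw [cb] at h1 ⊢
  obtain ⟨p, _, hp⟩ := Finset.exists_ne_zero_of_sum_ne_zero h1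
  refine Finset.sum_pos' (fun p _ => mul_nonneg (sq_nonneg _) (Finset.prod_nonneg fun a _ => (hw' _).le)) ⟨p, Finset.mem_univ _, ?_⟩
  have : (Matrix.of fun a b => v (p a) b).det ≠ 0 := by
    intro h; simp [h] at hp
  exact mul_pos (by positivity) (Finset.prod_pos fun a _ => hw' _)

lemma det_logconvex (l : ℝ) (hl : 0 < l) (hl1 : l < 1) (n k : ℕ) (v : Fin n → Fin k → ℝ)
    (w w' : Fin n → ℝ) (hw : ∀ i, 0 < w i) (hw' : ∀ i, 0 < w' i) :
    (∑ i, (w i ^ l * w' i ^ (1 - l)) • Matrix.vecMulVec (v i) (v i)).det ≤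
    (∑ i, w i • Matrix.vecMulVec (v i) (v i)).det ^ l *
    (∑ i, w' i • Matrix.vecMulVec (v i) (v i)).det ^ (1 - l) := by
  have hk : (0 : ℝ) < k.factorial := by positivity
  have := holder l hl hl1 (fun p : Fin k → Fin n => (Matrix.of fun a b => v (p a) b).det ^ 2)
    (fun p => ∏ a, w (p a)) (fun p => ∏ a, w' (p a)) (fun _ => sq_nonneg _)
    (fun p => Finset.prod_nonneg fun a _ => (hw _).le)
    (fun p => Finset.prod_nonneg fun a _ => (hw' _).le)
  rw [← cb, ← cb, Real.mul_rpow hk.le (det_nonneg' n k v w hw),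
    Real.mul_rpow hk.le (det_nonneg' n k v w' hw'), mul_mul_mul_comm, ← Real.rpow_add hk] at this
  simp only [← Real.finsetProd_rpow _ _ (fun _ _ => (hw _).le),
    ← Real.finsetProd_rpow _ _ (fun _ _ => (hw' _).le), ← Finset.prod_mul_distrib] at this
  rw [← cb n k v (fun i => w i ^ l * w' i ^ (1 - l))] at this
  rw [add_sub_cancel, Real.rpow_one] at this
  exact le_of_mul_le_mul_left this hk

lemma integrand_ineq (l : ℝ) (hl : 0 < l) (hl1 : l < 1) (n k : ℕ) (v : Fin n → Fin k → ℝ)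
    (s t x y : Fin n → ℝ) (hx : ∀ i, 0 < x i) (hy : ∀ i, 0 < y i) :
    (((∑ i, (Real.exp (s i) * x i) • Matrix.vecMulVec (v i) (v i)).det) ^ (-(1 : ℝ) / 2)
          * Real.exp (-∑ i, x i)) ^ l *
    (((∑ i, (Real.exp (t i) * y i) • Matrix.vecMulVec (v i) (v i)).det) ^ (-(1 : ℝ) / 2)
          * Real.exp (-∑ i, y i)) ^ (1 - l) ≤
    ((∑ i, (Real.exp ((l • s + (1 - l) • t) i) * (x i ^ l * y i ^ (1 - l))) • Matrix.vecMulVec (v i) (v i)).det) ^ (-(1 : ℝ) / 2)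
          * Real.exp (-∑ i, (x i ^ l * y i ^ (1 - l))) := by
  have hl2 : 0 < 1 - l := by linarith
  have hw : ∀ i, 0 < Real.exp (s i) * x i := fun i => mul_pos (Real.exp_pos _) (hx i)
  have hw' : ∀ i, 0 < Real.exp (t i) * y i := fun i => mul_pos (Real.exp_pos _) (hy i)
  have hz : ∀ i, 0 < Real.exp ((l • s + (1 - l) • t) i) * (x i ^ l * y i ^ (1 - l)) := fun i =>
    mul_pos (Real.exp_pos _) (mul_pos (Real.rpow_pos_of_pos (hx i) _) (Real.rpow_pos_of_pos (hy i) _))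
  have ez : ∀ i, Real.exp ((l • s + (1 - l) • t) i) * (x i ^ l * y i ^ (1 - l)) =
      (Real.exp (s i) * x i) ^ l * (Real.exp (t i) * y i) ^ (1 - l) := by
    intro i
    rw [Real.mul_rpow (Real.exp_pos _).le (hx i).le, Real.mul_rpow (Real.exp_pos _).le (hy i).le,
      mul_mul_mul_comm, ← Real.exp_mul, ← Real.exp_mul, ← Real.exp_add]
    simp [mul_comm]
  have D := det_logconvex l hl hl1 n k v _ _ hw hw'
  simp only [← ez] at D
  by_cases h0 : (∑ i, (Real.exp (s i) * x i) • Matrix.vecMulVec (v i) (v i)).det = 0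
  · rw [h0, Real.zero_rpow (by norm_num), zero_mul, Real.zero_rpow hl.ne', zero_mul]
    exact mul_nonneg (Real.rpow_nonneg (det_nonneg' _ _ _ _ hz) _) (Real.exp_pos _).le
  have d1 := det_pos' n k v _ _ hw hw h0
  have d2 := det_pos' n k v _ _ hw hw' h0
  have d3 := det_pos' n k v _ _ hw hz h0
  rw [Real.mul_rpow (Real.rpow_nonneg d1.le _) (Real.exp_pos _).le,
    Real.mul_rpow (Real.rpow_nonneg d2.le _) (Real.exp_pos _).le, mul_mul_mul_comm]
  apply mul_le_mul
  · rw [← Real.rpow_mul d1.le, ← Real.rpow_mul d2.le, mul_comm _ l, mul_comm _ (1 - l),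
      Real.rpow_mul d1.le, Real.rpow_mul d2.le,
      ← Real.mul_rpow (Real.rpow_nonneg d1.le _) (Real.rpow_nonneg d2.le _)]
    exact Real.rpow_le_rpow_of_nonpos d3 D (by norm_num)
  · rw [← Real.exp_mul, ← Real.exp_mul, ← Real.exp_add, Real.exp_le_exp]
    have : ∑ i, (x i ^ l * y i ^ (1 - l)) ≤ ∑ i, (l * x i + (1 - l) * y i) :=
      Finset.sum_le_sum fun i _ => Real.geom_mean_le_arith_mean2_weighted hl.le hl2.le (hx i).le (hy i).le (by ring)
    rw [Finset.sum_add_distrib, ← Finset.mul_sum, ← Finset.mul_sum] at this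
    linarith
  · positivity
  · exact Real.rpow_nonneg d3.le _

theorem stmt12 (n k : ℕ) (v : Fin n → Fin k → ℝ)
    (hspan : Submodule.span ℝ (Set.range v) = ⊤)
    (F : (Fin n → ℝ) → ℝ)
    (hF : ∀ t, F t = ∫ y in {y : Fin n → ℝ | ∀ i, 0 < y i},
        ((∑ i, (Real.exp (t i) * y i) • Matrix.vecMulVec (v i) (v i)).det) ^ (-(1 : ℝ) / 2)
          * Real.exp (-∑ i, y i))
    (hfin : ∀ t : Fin n → ℝ, IntegrableOn
        (fun y : Fin n → ℝ =>
          ((∑ i, (Real.exp (t i) * y i) • Matrix.vecMulVec (v i) (v i)).det) ^ (-(1 : ℝ) / 2)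
            * Real.exp (-∑ i, y i))
        {y : Fin n → ℝ | ∀ i, 0 < y i}) :
    ∀ s t : Fin n → ℝ, ∀ l : ℝ, 0 ≤ l → l ≤ 1 →
      F s ^ l * F t ^ (1 - l) ≤ F (l • s + (1 - l) • t) := by
  intro s t l hl0 hl1'
  rcases hl0.eq_or_lt with rfl | hl
  · simp
  rcases hl1'.eq_or_lt with rfl | hl1
  · simp
  have hl2 : 0 < 1 - l := by linarith
  set φ : (Fin n → ℝ) → (Fin n → ℝ) → ℝ := fun t y =>
    ((∑ i, (Real.exp (t i) * y i) • Matrix.vecMulVec (v i) (v i)).det) ^ (-(1 : ℝ) / 2)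
            * Real.exp (-∑ i, y i) with hφ
  have hset : {y : Fin n → ℝ | ∀ i, 0 < y i} = Set.univ.pi fun _ => Set.Ioi 0 := by
    ext; simp
  have hms : MeasurableSet {y : Fin n → ℝ | ∀ i, 0 < y i} := by
    rw [hset]; exact MeasurableSet.univ_pi fun _ => measurableSet_Ioi
  have hmu : (volume : Measure (Fin n → ℝ)).restrict {y : Fin n → ℝ | ∀ i, 0 < y i} =
      Measure.pi fun _ => volume.restrict (Set.Ioi (0 : ℝ)) := by
    rw [hset, volume_pi, Measure.restrict_pi_pi]
  have hm : ∀ t, Measurable (φ t) := by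
    intro t
    apply Measurable.mul
    · refine Measurable.pow_const ?_ _
      apply Continuous.measurable
      apply Continuous.matrix_det
      fun_prop
    · fun_prop
  have hpos : ∀ t y, (∀ i, 0 < y i) → 0 ≤ φ t y := fun t y hy =>
    mul_nonneg (Real.rpow_nonneg (det_nonneg' _ _ _ _ fun i => mul_pos (Real.exp_pos _) (hy i)) _)
      (Real.exp_pos _).le
  have hae : ∀ t, 0 ≤ᵐ[(volume : Measure (Fin n → ℝ)).restrict {y : Fin n → ℝ | ∀ i, 0 < y i}] φ t :=
    fun t => (ae_restrict_iff' hms).2 (.of_forall fun y hy => hpos t y hy)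
  have hF' : ∀ t, ENNReal.ofReal (F t) =
      ∫⁻ y, ENNReal.ofReal (φ t y) ∂(Measure.pi fun _ => volume.restrict (Set.Ioi (0 : ℝ))) := by
    intro t
    rw [hF t, ← hmu]
    exact ofReal_integral_eq_lintegral_ofReal (hfin t) (hae t)
  have hFn : ∀ t, 0 ≤ F t := fun t => by
    rw [hF t]; exact integral_nonneg_of_ae (hae t)
  have key := pl_mul l hl hl1 n (fun y => ENNReal.ofReal (φ s y)) (fun y => ENNReal.ofReal (φ t y))
    (fun y => ENNReal.ofReal (φ (l • s + (1 - l) • t) y)) (hm _).ennreal_ofReal (hm _).ennreal_ofReal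
    (hm _).ennreal_ofReal (by
      intro x y hx hy
      rw [ENNReal.ofReal_rpow_of_nonneg (hpos _ _ hx) hl.le,
        ENNReal.ofReal_rpow_of_nonneg (hpos _ _ hy) hl2.le,
        ← ENNReal.ofReal_mul (Real.rpow_nonneg (hpos _ _ hx) _)]
      exact ENNReal.ofReal_le_ofReal (integrand_ineq l hl hl1 n k v s t x y hx hy))
  rw [← hF', ← hF', ← hF', ENNReal.ofReal_rpow_of_nonneg (hFn _) hl.le,
    ENNReal.ofReal_rpow_of_nonneg (hFn _) hl2.le, ← ENNReal.ofReal_mul (Real.rpow_nonneg (hFn _) _)] at key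
  exact (ENNReal.ofReal_le_ofReal_iff (hFn _)).1 key
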